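/- arXiv:1705.04910 — 2 statements merged into one kernel-verified Lean document; each statement's English description precedes it below -/
import Mathlib

section
/- (i) For all x, y ∈ Δ, 2(x·y) ∈ ℤ[τ], where x·y is the standard Euclidean inner product of ℝ⁴. (ii) For all x ∈ Δ̇ and y ∈ Δ̇', 2(x·y) ∉ ℤ[τ]. -/
noncomputable section

/-- The golden ratio τ = (1+√5)/2. -/
def gr : ℝ := (1 + Real.sqrt 5) / 2

/-- The ring ℤ[τ] as a subset of ℝ. -/
def Ztau : Set ℝ := {x : ℝ | ∃ a b : ℤ, x = (a : ℝ) + (b : ℝ) * gr}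

/-- The H₄ root system with parameter t (t = τ gives Δ, t = 1-τ = τ' gives Δ'). -/
def DeltaSet (t : ℝ) : Set (Fin 4 → ℝ) :=
  {x | (∃ i, (x i = 1 ∨ x i = -1) ∧ ∀ j, j ≠ i → x j = 0)
    ∨ (∀ i, x i = 1/2 ∨ x i = -1/2)
    ∨ (∃ σ : Equiv.Perm (Fin 4), Equiv.Perm.sign σ = 1 ∧
        ∃ ε : Fin 4 → ℝ, (∀ i, ε i = 1 ∨ ε i = -1) ∧
          ∀ i, x i = ε i * (![0, 1, 1 - t, t] (σ i)) / 2)}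

/-- K = Δ ∩ Δ', the rational roots. -/
def Kset : Set (Fin 4 → ℝ) := DeltaSet gr ∩ DeltaSet (1 - gr)

theorem gr_sq : gr * gr = gr + 1 := by
  have h := Real.goldenRatio_sq
  rw [sq] at h
  exact h

/-- The subring ℤ[τ] of ℝ. -/
def ztauSubring : Subring ℝ where
  carrier := Ztau
  zero_mem' := ⟨0, 0, by simp⟩
  one_mem' := ⟨1, 0, by simp⟩
  add_mem' := by
    rintro _ _ ⟨a, b, rfl⟩ ⟨c, d, rfl⟩
    exact ⟨a + c, b + d, by push_cast; ring⟩
  neg_mem' := by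
    rintro _ ⟨a, b, rfl⟩
    exact ⟨-a, -b, by push_cast; ring⟩
  mul_mem' := by
    rintro _ _ ⟨a, b, rfl⟩ ⟨c, d, rfl⟩
    refine ⟨a * c + b * d, a * d + b * c + b * d, ?_⟩
    push_cast
    linear_combination (b * d : ℝ) * gr_sq

theorem mem_ztauSubring {x : ℝ} : x ∈ ztauSubring ↔ x ∈ Ztau := Iff.rfl

theorem gr_mem_ztauSubring : gr ∈ ztauSubring := ⟨0, 1, by simp⟩

theorem intCast_add_intCast_mul_gr_inj {a b c d : ℤ}
    (h : (a : ℝ) + b * gr = c + d * gr) : a = c ∧ b = d := by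
  have hbd : b = d := by
    by_contra hne
    have hirr : Irrational (((b - d : ℤ) : ℝ) * gr) :=
      Irrational.intCast_mul Real.goldenRatio_irrational (sub_ne_zero.mpr hne)
    refine hirr.ne_int (c - a) ?_
    push_cast
    linear_combination h
  subst hbd
  exact ⟨by exact_mod_cast add_right_cancel h, rfl⟩

theorem half_mem_ztauSubring_iff (a b : ℤ) :
    ((a : ℝ) + b * gr) / 2 ∈ ztauSubring ↔ 2 ∣ a ∧ 2 ∣ b := by
  constructor
  · rintro ⟨c, d, h⟩
    obtain ⟨ha, hb⟩ := intCast_add_intCast_mul_gr_inj (a := a) (b := b)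
      (c := 2 * c) (d := 2 * d) (by push_cast; linear_combination 2 * h)
    exact ⟨⟨c, ha⟩, ⟨d, hb⟩⟩
  · rintro ⟨⟨c, rfl⟩, ⟨d, rfl⟩⟩
    exact ⟨c, d, by push_cast; ring⟩

/-- `2x ≡ w` modulo `2ℤ[τ]`, coordinatewise, with `w` a vector over ℤ[τ]. -/
def DoubleReducesTo (x w : Fin 4 → ℝ) : Prop :=
  (∀ i, w i ∈ ztauSubring) ∧ ∀ i, x i - w i / 2 ∈ ztauSubring

theorem DoubleReducesTo.two_mul_sum_mem_iff {x y w z : Fin 4 → ℝ}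
    (hx : DoubleReducesTo x w) (hy : DoubleReducesTo y z) :
    2 * ∑ i, x i * y i ∈ ztauSubring ↔ (∑ i, w i * z i) / 2 ∈ ztauSubring := by
  have hsum : 2 * ∑ i, x i * y i = (∑ i, w i * z i) / 2 +
      ∑ i, ((x i - w i / 2) * z i + w i * (y i - z i / 2) +
        2 * ((x i - w i / 2) * (y i - z i / 2))) := by
    rw [Finset.mul_sum, Finset.sum_div, ← Finset.sum_add_distrib]
    exact Finset.sum_congr rfl fun i _ => by ring
  rw [hsum]
  refine add_mem_cancel_right (sum_mem fun i _ => ?_)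
  exact add_mem (add_mem (mul_mem (hx.2 i) (hy.1 i)) (mul_mem (hx.1 i) (hy.2 i)))
    (mul_mem (ofNat_mem _ 2) (mul_mem (hx.2 i) (hy.2 i)))

/-- The coordinates `0, 1, 1 - τ, τ` of the irrational roots, doubled and without signs. -/
def coordVec : Fin 4 → ℝ := ![0, 1, 1 - gr, gr]

theorem coordVec_eq (i : Fin 4) :
    coordVec i = ((![0, 1, 1, 0] i : ℤ) : ℝ) + ((![0, 0, -1, 1] i : ℤ) : ℝ) * gr := by
  fin_cases i <;> simp [coordVec, sub_eq_add_neg]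

theorem coordVec_mem (i : Fin 4) : coordVec i ∈ ztauSubring :=
  ⟨_, _, coordVec_eq i⟩

/-- The pairing of `coordVec` with its permutation by `π` is even exactly for even `π`. -/
theorem half_sum_coordVec_mul_mem_iff (π : Equiv.Perm (Fin 4)) :
    (∑ i, coordVec i * coordVec (π i)) / 2 ∈ ztauSubring ↔ Equiv.Perm.sign π = 1 := by
  let A : Fin 4 → ℤ := ![0, 1, 1, 0]
  let B : Fin 4 → ℤ := ![0, 0, -1, 1]
  have hsum : ∑ i, coordVec i * coordVec (π i) =
      ((∑ i, (A i * A (π i) + B i * B (π i)) : ℤ) : ℝ) +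
      ((∑ i, (A i * B (π i) + B i * A (π i) + B i * B (π i)) : ℤ) : ℝ) * gr := by
    push_cast
    rw [Finset.sum_mul, ← Finset.sum_add_distrib]
    refine Finset.sum_congr rfl fun i _ => ?_
    rw [coordVec_eq, coordVec_eq]
    linear_combination ((B i : ℝ) * B (π i)) * gr_sq
  rw [hsum, half_mem_ztauSubring_iff]
  clear hsum
  revert π
  decide

theorem half_sum_coordVec_perm_mem_iff (σ ρ : Equiv.Perm (Fin 4)) :
    (∑ i, coordVec (σ i) * coordVec (ρ i)) / 2 ∈ ztauSubring ↔
      Equiv.Perm.sign σ = Equiv.Perm.sign ρ := by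
  have hsum : ∑ i, coordVec (σ i) * coordVec (ρ i) =
      ∑ i, coordVec i * coordVec ((ρ * σ⁻¹) i) :=
    Fintype.sum_equiv σ _ _ fun i => by simp
  rw [hsum, half_sum_coordVec_mul_mem_iff, map_mul, map_inv, mul_inv_eq_one, eq_comm]

theorem doubleReducesTo_coordVec {x ε : Fin 4 → ℝ} {σ : Equiv.Perm (Fin 4)}
    (hε : ∀ i, ε i = 1 ∨ ε i = -1) (hx : ∀ i, x i = ε i * coordVec (σ i) / 2) :
    DoubleReducesTo x fun i => coordVec (σ i) := by
  refine ⟨fun i => coordVec_mem _, fun i => ?_⟩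
  rw [hx]
  rcases hε i with h | h <;> rw [h]
  · simp
  · convert neg_mem (coordVec_mem (σ i)) using 1
    ring

theorem doubleReducesTo_zero {x : Fin 4 → ℝ} {i : Fin 4} (hi : x i = 1 ∨ x i = -1)
    (hx : ∀ j, j ≠ i → x j = 0) : DoubleReducesTo x fun _ => 0 := by
  refine ⟨fun _ => zero_mem _, fun j => ?_⟩
  rw [zero_div, sub_zero]
  by_cases hj : j = i
  · subst hj
    rcases hi with h | h <;> rw [h]
    · exact one_mem _
    · exact neg_mem (one_mem _)
  · rw [hx j hj]
    exact zero_mem _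

theorem doubleReducesTo_one {x : Fin 4 → ℝ} (hx : ∀ i, x i = 1 / 2 ∨ x i = -1 / 2) :
    DoubleReducesTo x fun _ => 1 := by
  refine ⟨fun _ => one_mem _, fun i => ?_⟩
  rcases hx i with h | h <;> rw [h]
  · simp
  · convert neg_mem (one_mem ztauSubring) using 1
    norm_num

theorem exists_doubleReducesTo_of_mem_DeltaSet_gr {x : Fin 4 → ℝ} (hx : x ∈ DeltaSet gr) :
    ∃ w, DoubleReducesTo x w ∧ (w = (fun _ => 0) ∨ w = (fun _ => 1) ∨
      ∃ σ : Equiv.Perm (Fin 4), Equiv.Perm.sign σ = 1 ∧ w = fun i => coordVec (σ i)) := by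
  rcases hx with ⟨i, hi, h⟩ | h | ⟨σ, hσ, ε, hε, h⟩
  · exact ⟨_, doubleReducesTo_zero hi h, Or.inl rfl⟩
  · exact ⟨_, doubleReducesTo_one h, Or.inr (Or.inl rfl)⟩
  · exact ⟨_, doubleReducesTo_coordVec hε h, Or.inr (Or.inr ⟨σ, hσ, rfl⟩)⟩

theorem half_sum_coordVec_mem (σ : Equiv.Perm (Fin 4)) :
    (∑ i, coordVec (σ i)) / 2 ∈ ztauSubring := by
  rw [Equiv.sum_comp σ coordVec]
  convert one_mem ztauSubring using 1
  simp only [Fin.sum_univ_four, coordVec, Matrix.cons_val]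
  ring

theorem two_mul_sum_mem_of_mem_DeltaSet_gr {x y : Fin 4 → ℝ}
    (hx : x ∈ DeltaSet gr) (hy : y ∈ DeltaSet gr) :
    2 * ∑ i, x i * y i ∈ ztauSubring := by
  obtain ⟨w, hw, hw'⟩ := exists_doubleReducesTo_of_mem_DeltaSet_gr hx
  obtain ⟨z, hz, hz'⟩ := exists_doubleReducesTo_of_mem_DeltaSet_gr hy
  rw [hw.two_mul_sum_mem_iff hz]
  rcases hw' with rfl | rfl | ⟨σ, hσ, rfl⟩
  · simp
  · rcases hz' with rfl | rfl | ⟨ρ, -, rfl⟩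
    · simp
    · convert ofNat_mem ztauSubring 2 using 1
      norm_num
    · simpa using half_sum_coordVec_mem ρ
  · rcases hz' with rfl | rfl | ⟨ρ, hρ, rfl⟩
    · simp
    · simpa using half_sum_coordVec_mem σ
    · exact (half_sum_coordVec_perm_mem_iff σ ρ).mpr (hσ.trans hρ.symm)

theorem exists_perm_of_mem_DeltaSet_of_notMem {s t : ℝ} {x : Fin 4 → ℝ}
    (hs : x ∈ DeltaSet s) (ht : x ∉ DeltaSet t) :
    ∃ σ : Equiv.Perm (Fin 4), Equiv.Perm.sign σ = 1 ∧
      ∃ ε : Fin 4 → ℝ, (∀ i, ε i = 1 ∨ ε i = -1) ∧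
        ∀ i, x i = ε i * (![0, 1, 1 - s, s] (σ i)) / 2 := by
  rcases hs with h | h | h
  · exact absurd (Or.inl h) ht
  · exact absurd (Or.inr (Or.inl h)) ht
  · exact h

theorem conj_coordVec (i : Fin 4) :
    ![0, 1, 1 - (1 - gr), 1 - gr] i = coordVec (Equiv.swap 2 3 i) := by
  fin_cases i
  · rfl
  · rfl
  · exact sub_sub_cancel 1 gr
  · rfl

theorem two_mul_sum_notMem_of_irrational_roots {x y : Fin 4 → ℝ}
    (hx : x ∈ DeltaSet gr) (hx' : x ∉ DeltaSet (1 - gr))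
    (hy : y ∈ DeltaSet (1 - gr)) (hy' : y ∉ DeltaSet gr) :
    2 * ∑ i, x i * y i ∉ ztauSubring := by
  obtain ⟨σ, hσ, ε, hε, h⟩ := exists_perm_of_mem_DeltaSet_of_notMem hx hx'
  obtain ⟨ρ, hρ, δ, hδ, k⟩ := exists_perm_of_mem_DeltaSet_of_notMem hy hy'
  have hxσ := doubleReducesTo_coordVec hε h
  have hyρ := doubleReducesTo_coordVec (x := y) (σ := Equiv.swap 2 3 * ρ) hδ
    fun i => by rw [k, conj_coordVec]; rfl
  rw [hxσ.two_mul_sum_mem_iff hyρ, half_sum_coordVec_perm_mem_iff, map_mul, hσ, hρ,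
    Equiv.Perm.sign_swap (by decide)]
  decide

theorem statement1 :
    (∀ x ∈ DeltaSet gr, ∀ y ∈ DeltaSet gr, 2 * ∑ i, x i * y i ∈ Ztau) ∧
    (∀ x ∈ DeltaSet gr \ Kset, ∀ y ∈ DeltaSet (1 - gr) \ Kset,
      2 * ∑ i, x i * y i ∉ Ztau) :=
  ⟨fun _ hx _ hy => two_mul_sum_mem_of_mem_DeltaSet_gr hx hy,
    fun _ hx _ hy => two_mul_sum_notMem_of_irrational_roots hx.1 (fun h => hx.2 ⟨hx.1, h⟩)
      hy.1 (fun h => hy.2 ⟨h, hy.1⟩)⟩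
end
end

section
/- Let n ≥ 2. Then: (i) for all α ∈ Δ̇, r_α(𝒮ₙ) ⊆ 𝒮ₙ ∪ 𝒮̇ₙ₋₁'; (ii) for all α ∈ Δ̇, r_α(𝒮ₙ \ 𝒮̇ₙ) ⊆ 𝒮ₙ, and for each x ∈ 𝒮ₙ \ 𝒮̇ₙ there exists α ∈ Δ̇ with r_α(x) ∈ 𝒮̇ₙ; (iii) for each x ∈ 𝒮̇ₙ there are exactly three distinct reflections r_α with α ∈ Δ̇ (α and −α determining the same reflection) for which r_α(x) ∈ 𝒮̇ₙ₋₁'. -/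
noncomputable section

/-- Congruence modulo 2ℤ[τ]. -/
def cong2 (x y : ℝ) : Prop := ∃ a b : ℤ, x - y = 2 * ((a : ℝ) + (b : ℝ) * gr)

/-- The vector (0, 1, τ', τ) (for t = τ; its conjugate for t = τ'). -/
def v4 (t : ℝ) : Fin 4 → ℝ := ![0, 1, 1 - t, t]

/-- Representatives of the four classes of 𝔽₄ = ℤ[τ]/2ℤ[τ]. -/
def Reps : Set ℝ := {0, 1, gr, 1 + gr}

/-- `y` reduces mod 2ℤ[τ]⁴ into the 𝔽₄-span A of (1,1,1,1) and (0,1,τ',τ). -/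
def inAmod (t : ℝ) (y : Fin 4 → ℝ) : Prop :=
  ∃ c ∈ Reps, ∃ d ∈ Reps, ∀ i, cong2 (y i) (c + d * v4 t i)

/-- `y` reduces mod 2ℤ[τ]⁴ into Ȧ, the images of even permutations of (0,1,τ',τ). -/
def inAdot (t : ℝ) (y : Fin 4 → ℝ) : Prop :=
  ∃ σ : Equiv.Perm (Fin 4), Equiv.Perm.sign σ = 1 ∧ ∀ i, cong2 (y i) (v4 t (σ i))

/-- The spherical sets 𝒮ₙ (t = τ) resp. 𝒮ₙ' (t = τ'). -/
def sphS (t : ℝ) : ℕ → Set (Fin 4 → ℝ)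
  | 0 => {x | ∃ i, (x i = 1 ∨ x i = -1) ∧ ∀ j, j ≠ i → x j = 0}
  | (n+1) => {x | (∑ i, x i ^ 2) = 1 ∧ (∀ i, 2 ^ (n+1) * x i ∈ Ztau) ∧
      inAmod t (fun i => 2 ^ (n+1) * x i) ∧ ∃ i, ¬ cong2 (2 ^ (n+1) * x i) 0}

/-- The spherical sets 𝒮̇ₙ (t = τ) resp. 𝒮̇ₙ' (t = τ'). -/
def sphSdot (t : ℝ) (n : ℕ) : Set (Fin 4 → ℝ) :=
  {x | (∑ i, x i ^ 2) = 1 ∧ (∀ i, 2 ^ n * x i ∈ Ztau) ∧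
    inAdot t (fun i => 2 ^ n * x i)}

/-- The orthogonal reflection in the hyperplane orthogonal to the unit vector `a`:
`x ↦ x - 2(x·a)a`. -/
def reflv (a x : Fin 4 → ℝ) : Fin 4 → ℝ := fun i => x i - 2 * (∑ j, x j * a j) * a i

/-- The ring `ℤ[τ]`, with `τ` represented by `ω`. -/
abbrev GoldenInt := QuadraticAlgebra ℤ 1 1

/-- The field `ℤ[τ]/2ℤ[τ]` with four elements. -/
abbrev GoldenModTwo := QuadraticAlgebra (ZMod 2) 1 1

instance : Fintype GoldenModTwo := Fintype.ofEquiv _ (QuadraticAlgebra.equivProd 1 1).symm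

open QuadraticAlgebra

instance : NoZeroDivisors GoldenModTwo where
  eq_zero_or_eq_zero_of_mul_eq_zero {a b} := by
    revert a b; decide

theorem gr_mul_gr : gr * gr = 1 + gr := by
  rw [← pow_two, add_comm]
  exact Real.goldenRatio_sq

theorem gr_irrational : Irrational gr := Real.goldenRatio_irrational

/-- The embedding of `ℤ[τ]` into the real numbers. -/
def toReal : GoldenInt →+* ℝ where
  toFun z := z.re + z.im * gr
  map_zero' := by simp
  map_one' := by simp
  map_add' z w := by simp; ring
  map_mul' z w := by
    simp
    linear_combination (-z.im * w.im : ℝ) * gr_mul_gr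

/-- Reduction modulo two. -/
def modTwo : GoldenInt →+* GoldenModTwo where
  toFun z := ⟨z.re, z.im⟩
  map_zero' := by ext <;> simp
  map_one' := by ext <;> simp
  map_add' z w := by ext <;> simp
  map_mul' z w := by ext <;> simp

theorem toReal_apply (z : GoldenInt) : toReal z = z.re + z.im * gr := rfl

theorem toReal_injective : Function.Injective toReal := by
  rw [injective_iff_map_eq_zero]
  intro z hz
  rw [toReal_apply] at hz
  have him : z.im = 0 := by
    by_contra h
    refine (gr_irrational.intCast_mul h).intCast_add z.re ⟨0, ?_⟩
    simpa using hz.symm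
  ext
  · simpa [him] using hz
  · exact him

@[simp] theorem toReal_omega : toReal ω = gr := by simp [toReal_apply]

@[simp] theorem modTwo_omega : modTwo ω = ω := by ext <;> simp [modTwo]

theorem modTwo_surjective : Function.Surjective modTwo := fun z => by
  obtain ⟨a, ha⟩ := ZMod.intCast_surjective z.re
  obtain ⟨b, hb⟩ := ZMod.intCast_surjective z.im
  exact ⟨⟨a, b⟩, by ext <;> simp [modTwo, ha, hb]⟩

theorem modTwo_eq_zero_iff (a : GoldenInt) : modTwo a = 0 ↔ ∃ b, a = 2 * b := by
  constructor
  · intro h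
    have h1 : ((a.re : ℤ) : ZMod 2) = 0 := congrArg QuadraticAlgebra.re h
    have h2 : ((a.im : ℤ) : ZMod 2) = 0 := congrArg QuadraticAlgebra.im h
    rw [ZMod.intCast_zmod_eq_zero_iff_dvd] at h1 h2
    obtain ⟨p, hp⟩ := h1
    obtain ⟨q, hq⟩ := h2
    exact ⟨⟨p, q⟩, by ext <;> simp [hp, hq]⟩
  · rintro ⟨b, rfl⟩
    rw [map_mul, show modTwo 2 = 0 by ext <;> decide, zero_mul]

theorem modTwo_eq_iff (a b : GoldenInt) : modTwo a = modTwo b ↔ ∃ c, a = b + 2 * c := by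
  rw [← sub_eq_zero, ← map_sub, modTwo_eq_zero_iff]
  simp only [sub_eq_iff_eq_add']

theorem mem_Ztau_iff (x : ℝ) : x ∈ Ztau ↔ ∃ a, toReal a = x :=
  ⟨fun ⟨a, b, h⟩ => ⟨⟨a, b⟩, h.symm⟩, fun ⟨a, h⟩ => ⟨a.re, a.im, h.symm⟩⟩

theorem cong2_toReal_iff (a b : GoldenInt) :
    cong2 (toReal a) (toReal b) ↔ modTwo a = modTwo b := by
  rw [modTwo_eq_iff]
  constructor
  · rintro ⟨p, q, h⟩
    refine ⟨⟨p, q⟩, toReal_injective ?_⟩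
    rw [map_add, map_mul, map_ofNat, toReal_apply ⟨p, q⟩]
    linarith
  · rintro ⟨c, rfl⟩
    refine ⟨c.re, c.im, ?_⟩
    rw [map_add, map_mul, map_ofNat, toReal_apply c]
    ring

/-- The vector `(0, 1, 1 - t, t)`. -/
def quad {A : Type*} [Ring A] (t : A) : Fin 4 → A := ![0, 1, 1 - t, t]

theorem map_quad {A B : Type*} [Ring A] [Ring B] (f : A →+* B) (t : A) (i : Fin 4) :
    f (quad t i) = quad (f t) i := by
  fin_cases i <;> simp [quad]

theorem v4_eq_quad (t : ℝ) : v4 t = quad t := rfl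

/-- Membership in the span of `(1, 1, 1, 1)` and `(0, 1, 1 - t, t)` over the field with four
elements. -/
def InSpan (t : GoldenModTwo) (y : Fin 4 → GoldenModTwo) : Prop :=
  ∃ c d, ∀ i, y i = c + d * quad t i

/-- Membership in the set of even permutations of `(0, 1, 1 - t, t)`. -/
def InDot (t : GoldenModTwo) (y : Fin 4 → GoldenModTwo) : Prop :=
  ∃ σ : Equiv.Perm (Fin 4), Equiv.Perm.sign σ = 1 ∧ ∀ i, y i = quad t (σ i)

theorem exists_toReal_mem_Reps (c : GoldenModTwo) : ∃ a, modTwo a = c ∧ toReal a ∈ Reps := by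
  have h : ∀ c : GoldenModTwo, c = 0 ∨ c = 1 ∨ c = ω ∨ c = 1 + ω := by decide
  rcases h c with rfl | rfl | rfl | rfl
  · exact ⟨0, by simp, by simp [Reps]⟩
  · exact ⟨1, by simp, by simp [Reps]⟩
  · exact ⟨ω, by simp, by simp [Reps]⟩
  · exact ⟨1 + ω, by simp, by simp [Reps]⟩

theorem exists_toReal_eq_of_mem_Reps {c : ℝ} (hc : c ∈ Reps) : ∃ a, toReal a = c := by
  rcases hc with rfl | rfl | rfl | rfl
  · exact ⟨0, by simp⟩
  · exact ⟨1, by simp⟩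
  · exact ⟨ω, by simp⟩
  · exact ⟨1 + ω, by simp⟩

theorem inAmod_toReal_iff (t : GoldenInt) (Y : Fin 4 → GoldenInt) :
    inAmod (toReal t) (fun i => toReal (Y i)) ↔ InSpan (modTwo t) (fun i => modTwo (Y i)) := by
  have key (a b : GoldenInt) (i : Fin 4) :
      cong2 (toReal (Y i)) (toReal a + toReal b * v4 (toReal t) i) ↔
        modTwo (Y i) = modTwo a + modTwo b * quad (modTwo t) i := by
    rw [v4_eq_quad, ← map_quad, ← map_quad, ← map_mul, ← map_mul, ← map_add, ← map_add,
      cong2_toReal_iff]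
  constructor
  · rintro ⟨c, hc, d, hd, h⟩
    obtain ⟨a, rfl⟩ := exists_toReal_eq_of_mem_Reps hc
    obtain ⟨b, rfl⟩ := exists_toReal_eq_of_mem_Reps hd
    exact ⟨modTwo a, modTwo b, fun i => (key a b i).1 (h i)⟩
  · rintro ⟨c, d, h⟩
    obtain ⟨a, rfl, ha⟩ := exists_toReal_mem_Reps c
    obtain ⟨b, rfl, hb⟩ := exists_toReal_mem_Reps d
    exact ⟨_, ha, _, hb, fun i => (key a b i).2 (h i)⟩

theorem inAdot_toReal_iff (t : GoldenInt) (Y : Fin 4 → GoldenInt) :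
    inAdot (toReal t) (fun i => toReal (Y i)) ↔ InDot (modTwo t) (fun i => modTwo (Y i)) := by
  simp only [inAdot, InDot, v4_eq_quad, ← map_quad, cong2_toReal_iff]

theorem sum_sq_eq_one_iff {n : ℕ} {x : Fin 4 → ℝ} {Y : Fin 4 → GoldenInt}
    (h : ∀ i, 2 ^ n * x i = toReal (Y i)) : ∑ i, x i ^ 2 = 1 ↔ ∑ i, Y i ^ 2 = 4 ^ n := by
  rw [← toReal_injective.eq_iff, map_sum]
  simp only [map_pow, ← h, mul_pow, ← Finset.mul_sum, map_ofNat, ← pow_mul, mul_comm n]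
  rw [pow_mul]
  norm_num

theorem mem_sphS_iff {n : ℕ} (hn : n ≠ 0) {x : Fin 4 → ℝ} {Y : Fin 4 → GoldenInt} (t : GoldenInt)
    (h : ∀ i, 2 ^ n * x i = toReal (Y i)) :
    x ∈ sphS (toReal t) n ↔ ∑ i, Y i ^ 2 = 4 ^ n ∧
      InSpan (modTwo t) (fun i => modTwo (Y i)) ∧ ∃ i, modTwo (Y i) ≠ 0 := by
  obtain ⟨n, rfl⟩ := Nat.exists_eq_succ_of_ne_zero hn
  have h0 (a : GoldenInt) : cong2 (toReal a) 0 ↔ modTwo a = 0 := by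
    simpa using cong2_toReal_iff a 0
  simp only [sphS, Set.mem_ofPred_eq, h, h0, inAmod_toReal_iff, sum_sq_eq_one_iff h, mem_Ztau_iff,
    exists_apply_eq_apply, implies_true, true_and]

theorem mem_sphSdot_iff {n : ℕ} {x : Fin 4 → ℝ} {Y : Fin 4 → GoldenInt} (t : GoldenInt)
    (h : ∀ i, 2 ^ n * x i = toReal (Y i)) :
    x ∈ sphSdot (toReal t) n ↔ ∑ i, Y i ^ 2 = 4 ^ n ∧
      InDot (modTwo t) (fun i => modTwo (Y i)) := by
  simp only [sphSdot, Set.mem_ofPred_eq, h, inAdot_toReal_iff, sum_sq_eq_one_iff h, mem_Ztau_iff,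
    exists_apply_eq_apply, implies_true, true_and]

theorem exists_toReal_eq_of_mem_sphS {n : ℕ} (hn : n ≠ 0) {t : ℝ} {x : Fin 4 → ℝ}
    (hx : x ∈ sphS t n) : ∃ Y : Fin 4 → GoldenInt, ∀ i, 2 ^ n * x i = toReal (Y i) := by
  obtain ⟨n, rfl⟩ := Nat.exists_eq_succ_of_ne_zero hn
  choose Y hY using fun i => (mem_Ztau_iff _).1 (hx.2.1 i)
  exact ⟨Y, fun i => (hY i).symm⟩

theorem exists_toReal_eq_of_mem_sphSdot {n : ℕ} {t : ℝ} {x : Fin 4 → ℝ}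
    (hx : x ∈ sphSdot t n) : ∃ Y : Fin 4 → GoldenInt, ∀ i, 2 ^ n * x i = toReal (Y i) := by
  choose Y hY using fun i => (mem_Ztau_iff _).1 (hx.2.1 i)
  exact ⟨Y, fun i => (hY i).symm⟩

theorem exists_perm_quad_omega : ∀ c d : GoldenModTwo, d ≠ 0 →
    ∃ σ : Equiv.Perm (Fin 4), Equiv.Perm.sign σ = 1 ∧
      ∀ i, c + d * quad ω i = quad ω (σ i) := by
  decide

theorem exists_perm_quad_one_sub_omega : ∀ c d : GoldenModTwo, d ≠ 0 →
    ∃ σ : Equiv.Perm (Fin 4), Equiv.Perm.sign σ = 1 ∧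
      ∀ i, c + d * quad (1 - ω) i = quad (1 - ω) (σ i) := by
  decide

theorem perm_quad_eq : ∀ σ : Equiv.Perm (Fin 4), Equiv.Perm.sign σ = 1 →
    ∀ i, (quad ω (σ i) : GoldenModTwo) =
      quad ω (σ 0) + (quad ω (σ 1) - quad ω (σ 0)) * quad ω i := by
  decide

theorem quad_omega_injective : Function.Injective (quad (ω : GoldenModTwo)) := by
  decide

theorem quad_perm_ne : ∀ σ : Equiv.Perm (Fin 4), Equiv.Perm.sign σ = 1 →
    ∃ i, (quad ω (σ i) : GoldenModTwo) ≠ quad (1 - ω) i := by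
  decide

theorem two_eq_zero_modTwo : (2 : GoldenModTwo) = 0 := by decide

theorem exists_mul_eq_one : ∀ a : GoldenModTwo, a ≠ 0 → ∃ u, a * u = 1 := by
  decide

/-- Twice the irrational elements of the `H₄` root system. -/
def IsRoot (β : Fin 4 → GoldenInt) : Prop :=
  ∃ σ : Equiv.Perm (Fin 4), Equiv.Perm.sign σ = 1 ∧
    ∃ ε : Fin 4 → GoldenInt, (∀ i, ε i = 1 ∨ ε i = -1) ∧ ∀ i, β i = ε i * quad ω (σ i)

theorem modTwo_sign {a : GoldenInt} (h : a = 1 ∨ a = -1) : modTwo a = 1 := by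
  rcases h with rfl | rfl
  · simp
  · rw [map_neg, map_one]
    decide

theorem sign_sq {a : GoldenInt} (h : a = 1 ∨ a = -1) : a ^ 2 = 1 := by
  rcases h with rfl | rfl <;> norm_num

theorem IsRoot.inDot {β : Fin 4 → GoldenInt} (h : IsRoot β) :
    InDot ω (fun i => modTwo (β i)) := by
  obtain ⟨σ, hσ, ε, hε, h⟩ := h
  exact ⟨σ, hσ, fun i => by simp only [h, map_mul, modTwo_sign (hε i), one_mul, map_quad, modTwo_omega]⟩

theorem sum_quad_omega_sq : ∑ i, (quad ω i : GoldenInt) ^ 2 = 4 := by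
  decide

theorem IsRoot.sum_sq {β : Fin 4 → GoldenInt} (h : IsRoot β) : ∑ i, β i ^ 2 = 4 := by
  obtain ⟨σ, -, ε, hε, h⟩ := h
  simp only [h, mul_pow, sign_sq (hε _), one_mul]
  rw [Equiv.sum_comp σ (fun i => (quad ω i : GoldenInt) ^ 2), sum_quad_omega_sq]

theorem InDot.inSpan {y : Fin 4 → GoldenModTwo} (h : InDot ω y) : InSpan ω y := by
  obtain ⟨σ, hσ, h⟩ := h
  exact ⟨_, _, fun i => (h i).trans (perm_quad_eq σ hσ i)⟩

theorem InDot.exists_ne_zero {t : GoldenModTwo} {y : Fin 4 → GoldenModTwo} (h : InDot t y) :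
    ∃ i, y i ≠ 0 := by
  obtain ⟨σ, -, h⟩ := h
  exact ⟨σ.symm 1, by rw [h]; simp [quad]⟩

theorem InSpan.sub_mul {t e : GoldenModTwo} {y z : Fin 4 → GoldenModTwo} (hy : InSpan t y)
    (hz : InSpan t z) : InSpan t (fun i => y i - e * z i) := by
  obtain ⟨c, d, h⟩ := hy
  obtain ⟨c', d', h'⟩ := hz
  exact ⟨c - e * c', d - e * d', fun i => by simp only [h, h']; ring⟩

theorem InSpan.sum_mul_eq_zero {y z : Fin 4 → GoldenModTwo} (hy : InSpan ω y)
    (hz : InSpan ω z) : ∑ i, y i * z i = 0 := by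
  obtain ⟨c, d, h⟩ := hy
  obtain ⟨c', d', h'⟩ := hz
  simp only [h, h']
  have h0 : ∀ c d c' d' : GoldenModTwo,
      ∑ i, (c + d * quad ω i) * (c' + d' * quad ω i) = 0 := by decide
  exact h0 c d c' d'

theorem InSpan.inDot_or {y : Fin 4 → GoldenModTwo} (h : InSpan ω y) :
    InDot ω y ∨ ∃ c, ∀ i, y i = c := by
  obtain ⟨c, d, h⟩ := h
  by_cases hd : d = 0
  · exact .inr ⟨c, fun i => by rw [h, hd, zero_mul, add_zero]⟩
  · obtain ⟨σ, hσ, hs⟩ := exists_perm_quad_omega c d hd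
    exact .inl ⟨σ, hσ, fun i => (h i).trans (hs i)⟩

theorem InDot.not_const {y : Fin 4 → GoldenModTwo} (h : InDot ω y) (c : GoldenModTwo) :
    ∃ i, y i ≠ c := by
  obtain ⟨σ, -, h⟩ := h
  by_contra! hc
  have h01 := σ.injective (quad_omega_injective (a₁ := σ 0) (a₂ := σ 1)
    (by rw [← h, ← h, hc, hc]))
  exact absurd h01 (by decide)

theorem IsRoot.exists_sum_mul_eq {β Y : Fin 4 → GoldenInt} (hβ : IsRoot β)
    (hY : InSpan ω (fun i => modTwo (Y i))) : ∃ c, ∑ i, Y i * β i = 2 * c := by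
  rw [← modTwo_eq_zero_iff, map_sum]
  simp only [map_mul]
  exact hY.sum_mul_eq_zero hβ.inDot.inSpan

theorem sum_reflection_sq {R : Type*} [CommRing R] {Y β : Fin 4 → R} {c : R}
    (hβ : ∑ i, β i ^ 2 = 4) (hc : ∑ i, Y i * β i = 2 * c) :
    ∑ i, (Y i - c * β i) ^ 2 = ∑ i, Y i ^ 2 := by
  simp only [Fin.sum_univ_four] at *
  linear_combination c ^ 2 * hβ - 2 * c * hc

theorem two_mul_cancel {a b : GoldenInt} (h : 2 * a = 2 * b) : a = b := by
  apply toReal_injective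
  have := congrArg toReal h
  simp only [map_mul, map_ofNat] at this
  linarith

/-- An integral vector whose norm is divisible by four is congruent modulo two to an element of the
span of `(1, 1, 1, 1)` and `(0, 1, τ', τ)`, or of its conjugate. -/
theorem inSpan_or_of_sum_sq {z : Fin 4 → GoldenInt} {k : GoldenInt} (h : ∑ i, z i ^ 2 = 4 * k) :
    InSpan ω (fun i => modTwo (z i)) ∨ InSpan (1 - ω) (fun i => modTwo (z i)) := by
  have h4 : modTwo 4 = 0 := by rw [modTwo_eq_zero_iff]; exact ⟨2, by norm_num⟩
  have hsum : modTwo (z 0 + z 1 + z 2 + z 3) = 0 := by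
    have h' := congrArg modTwo h
    rw [map_mul, h4, zero_mul] at h'
    simp only [Fin.sum_univ_four, map_add, map_pow] at h'
    simp only [map_add]
    refine pow_eq_zero_iff two_ne_zero |>.1 ?_
    linear_combination h' + (modTwo (z 0) * modTwo (z 1) + modTwo (z 0) * modTwo (z 2) +
      modTwo (z 0) * modTwo (z 3) + modTwo (z 1) * modTwo (z 2) + modTwo (z 1) * modTwo (z 3) +
      modTwo (z 2) * modTwo (z 3)) * two_eq_zero_modTwo
  obtain ⟨s, hs⟩ := (modTwo_eq_zero_iff _).1 hsum
  have hz3 : z 3 = 2 * s - z 0 - z 1 - z 2 := by linear_combination hs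
  have hq : modTwo ((z 1 - z 0) ^ 2 + (z 1 - z 0) * (z 2 - z 0) + (z 2 - z 0) ^ 2) = 0 := by
    rw [modTwo_eq_zero_iff]
    simp only [Fin.sum_univ_four] at h
    refine ⟨k - s ^ 2 + s * (z 0 + z 1 + z 2) + z 0 ^ 2 - 2 * z 0 * (z 1 + z 2), ?_⟩
    apply two_mul_cancel
    rw [hz3] at h
    linear_combination h
  simp only [map_add, map_sub, map_mul, map_pow] at hq hsum
  have h3 : modTwo (z 3) = -(modTwo (z 0) + modTwo (z 1) + modTwo (z 2)) := by
    linear_combination hsum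
  have key : ∀ a b c : GoldenModTwo, (b - a) ^ 2 + (b - a) * (c - a) + (c - a) ^ 2 = 0 →
      (∀ i, ![a, b, c, -(a + b + c)] i = a + (b - a) * quad ω i) ∨
      (∀ i, ![a, b, c, -(a + b + c)] i = a + (b - a) * quad (1 - ω) i) := by decide
  have hv : (fun i => modTwo (z i)) =
      ![modTwo (z 0), modTwo (z 1), modTwo (z 2), -(modTwo (z 0) + modTwo (z 1) + modTwo (z 2))] := by
    ext1 i
    fin_cases i <;> simp [h3]
  rw [hv]
  exact (key _ _ _ hq).imp (fun h => ⟨_, _, h⟩) (fun h => ⟨_, _, h⟩)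

theorem inDot_of_reflection_eq_two_mul {n : ℕ} (hn : 2 ≤ n) {Y β z : Fin 4 → GoldenInt}
    {c : GoldenInt} (hβ : IsRoot β) (hY : ∑ i, Y i ^ 2 = 4 ^ n) (hc : ∑ i, Y i * β i = 2 * c)
    (hc0 : modTwo c ≠ 0) (hz : ∀ i, Y i - c * β i = 2 * z i) :
    ∑ i, z i ^ 2 = 4 ^ (n - 1) ∧ InDot (1 - ω) (fun i => modTwo (z i)) := by
  obtain ⟨m, rfl⟩ := Nat.exists_eq_add_of_le' hn
  have hsq : ∑ i, z i ^ 2 = 4 ^ (m + 1) := by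
    have h := sum_reflection_sq hβ.sum_sq hc
    simp only [hz, mul_pow, ← Finset.mul_sum, hY] at h
    apply two_mul_cancel
    apply two_mul_cancel
    rw [pow_succ _ (m + 1)] at h
    linear_combination h
  refine ⟨hsq, ?_⟩
  have hzβ : ∑ i, z i * β i = -c := by
    apply two_mul_cancel
    have h4 := hβ.sum_sq
    have h0 := hz 0
    have h1 := hz 1
    have h2 := hz 2
    have h3 := hz 3
    simp only [Fin.sum_univ_four] at *
    linear_combination hc - c * h4 - β 0 * h0 - β 1 * h1 - β 2 * h2 - β 3 * h3
  have hne : ¬ InSpan ω (fun i => modTwo (z i)) := by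
    intro h
    have h0 := h.sum_mul_eq_zero hβ.inDot.inSpan
    simp only [← map_mul, ← map_sum, hzβ, map_neg, neg_eq_zero] at h0
    exact hc0 h0
  rw [pow_succ'] at hsq
  obtain ⟨a, d, h⟩ := (inSpan_or_of_sum_sq hsq).resolve_left hne
  have hd : d ≠ 0 := by
    rintro rfl
    exact hne ⟨a, 0, fun i => by simpa using h i⟩
  obtain ⟨σ, hσ, hs⟩ := exists_perm_quad_one_sub_omega a d hd
  exact ⟨σ, hσ, fun i => (h i).trans (hs i)⟩

theorem isRoot_of_mem_DeltaSet {α : Fin 4 → ℝ} (h : α ∈ DeltaSet gr \ Kset) :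
    ∃ β, IsRoot β ∧ ∀ i, 2 * α i = toReal (β i) := by
  obtain ⟨h, hK⟩ := h
  rcases h with h | h | ⟨σ, hσ, ε, hε, h⟩
  · exact absurd ⟨.inl h, .inl h⟩ hK
  · exact absurd ⟨.inr (.inl h), .inr (.inl h)⟩ hK
  · have hex : ∀ i, ∃ e : GoldenInt, (e = 1 ∨ e = -1) ∧ toReal e = ε i := fun i => by
      rcases hε i with h | h
      · exact ⟨1, .inl rfl, by simp [h]⟩
      · exact ⟨-1, .inr rfl, by simp [h]⟩
    choose e he heε using hex
    refine ⟨fun i => e i * quad ω (σ i), ⟨σ, hσ, e, he, fun _ => rfl⟩, fun i => ?_⟩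
    rw [h, map_mul, map_quad, heε, toReal_omega, quad]
    ring

theorem IsRoot.mem_DeltaSet {β : Fin 4 → GoldenInt} (hβ : IsRoot β) :
    (fun i => toReal (β i) / 2) ∈ DeltaSet gr \ Kset := by
  obtain ⟨σ, hσ, ε, hε, h⟩ := hβ
  have hsign : ∀ i, toReal (ε i) = 1 ∨ toReal (ε i) = -1 := fun i => by
    rcases hε i with h | h <;> simp [h]
  have hα : ∀ i, toReal (β i) = toReal (ε i) * ![0, 1, 1 - gr, gr] (σ i) := fun i => by
    rw [h, map_mul, map_quad, toReal_omega, quad]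
  refine ⟨.inr (.inr ⟨σ, hσ, fun i => toReal (ε i), hsign, fun i => by simp only [hα]⟩), ?_⟩
  rintro ⟨-, h' | h' | ⟨σ', hσ', ε', hε', h'⟩⟩
  · obtain ⟨i, hi, h'⟩ := h'
    have h3 := hα (σ.symm 3)
    simp only [Equiv.apply_symm_apply] at h3
    have hcases : toReal (β (σ.symm 3)) / 2 = 1 ∨ toReal (β (σ.symm 3)) / 2 = -1 ∨
        toReal (β (σ.symm 3)) / 2 = 0 := by
      by_cases hi3 : σ.symm 3 = i
      · rw [hi3]
        tauto
      · exact .inr (.inr (h' _ hi3))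
    have h1 : (1 : ℝ) < gr := Real.one_lt_goldenRatio
    have h2 : gr < 2 := Real.goldenRatio_lt_two
    rw [h3] at hcases
    simp only [Matrix.cons_val] at hcases
    rcases hsign (σ.symm 3) with hs | hs <;> rw [hs] at hcases <;>
      rcases hcases with h | h | h <;> linarith
  · have h3 := hα (σ.symm 3)
    simp only [Equiv.apply_symm_apply] at h3
    have hcases := h' (σ.symm 3)
    simp only [h3] at hcases
    have h1 : (1 : ℝ) < gr := Real.one_lt_goldenRatio
    simp only [Matrix.cons_val] at hcases
    rcases hsign (σ.symm 3) with hs | hs <;> rw [hs] at hcases <;>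
      rcases hcases with h | h <;> linarith
  · have hmod : ∀ i, (quad ω (σ i) : GoldenModTwo) = quad (1 - ω) (σ' i) := fun i => by
      have hi := h' i
      have hq : ![0, 1, 1 - (1 - gr), 1 - gr] (σ' i) = toReal (quad (1 - ω) (σ' i)) := by
        rw [map_quad, map_sub, map_one, toReal_omega, quad]
      rw [hq] at hi
      have hi' : β i = quad (1 - ω) (σ' i) ∨ β i = - quad (1 - ω) (σ' i) := by
        rcases hε' i with hs | hs <;> rw [hs] at hi
        · exact .inl (toReal_injective (by linarith))
        · exact .inr (toReal_injective (by rw [map_neg]; linarith))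
      have hβ : modTwo (β i) = quad ω (σ i) := by
        rw [h, map_mul, modTwo_sign (hε i), one_mul, map_quad, modTwo_omega]
      rw [← hβ]
      have hq' : modTwo (quad (1 - ω) (σ' i)) = quad (1 - ω) (σ' i) := by
        rw [map_quad, map_sub, map_one, modTwo_omega]
      rcases hi' with hi' | hi'
      · rw [hi', hq']
      · rw [hi', map_neg, hq']
        generalize (quad (1 - ω) (σ' i) : GoldenModTwo) = a
        revert a
        decide
    obtain ⟨i, hi⟩ := quad_perm_ne (σ'.symm.trans σ) (by simp [hσ, hσ'])
    apply hi
    rw [Equiv.trans_apply, hmod, Equiv.apply_symm_apply]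

theorem two_pow_mul_reflv {n : ℕ} {x α : Fin 4 → ℝ} {Y β : Fin 4 → GoldenInt} {c : GoldenInt}
    (hx : ∀ i, 2 ^ n * x i = toReal (Y i)) (hα : ∀ i, 2 * α i = toReal (β i))
    (hc : ∑ i, Y i * β i = 2 * c) (i : Fin 4) :
    2 ^ n * reflv α x i = toReal (Y i - c * β i) := by
  have h : 2 ^ n * ∑ j, x j * α j = toReal c := by
    have h := congrArg toReal hc
    simp only [map_sum, map_mul, ← hx, ← hα, map_ofNat] at h
    have h' : ∑ j, 2 ^ n * x j * (2 * α j) = 2 * (2 ^ n * ∑ j, x j * α j) := by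
      simp only [Finset.mul_sum]
      exact Finset.sum_congr rfl fun j _ => by ring
    linarith
  rw [reflv, map_sub, map_mul, ← hx, ← hα, ← h]
  ring

theorem reflv_mem_sphSdot_iff {n : ℕ} (hn : 2 ≤ n) {x α : Fin 4 → ℝ} {Y β : Fin 4 → GoldenInt}
    {c : GoldenInt} (hβ : IsRoot β) (hx : ∀ i, 2 ^ n * x i = toReal (Y i))
    (hα : ∀ i, 2 * α i = toReal (β i)) (hc : ∑ i, Y i * β i = 2 * c)
    (hY : ∑ i, Y i ^ 2 = 4 ^ n) (hY0 : ∃ i, modTwo (Y i) ≠ 0) :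
    reflv α x ∈ sphSdot (1 - gr) (n - 1) ↔ ∀ i, modTwo (Y i) = modTwo c * modTwo (β i) := by
  have hpow (r : ℝ) : 2 ^ n * r = 2 * (2 ^ (n - 1) * r) := by
    rw [← mul_assoc, ← pow_succ', Nat.sub_add_cancel (by omega)]
  have hr := two_pow_mul_reflv hx hα hc
  constructor
  · intro h i
    obtain ⟨z, hz⟩ := exists_toReal_eq_of_mem_sphSdot h
    rw [← map_mul, modTwo_eq_iff]
    refine ⟨z i, toReal_injective ?_⟩
    have h' := hr i
    rw [hpow, hz, map_sub] at h'
    rw [map_add, map_mul toReal 2, map_ofNat]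
    linarith
  · intro h
    have hz : ∀ i, ∃ z, Y i = c * β i + 2 * z := fun i => by
      rw [← modTwo_eq_iff, h, map_mul]
    choose z hz using hz
    have hc0 : modTwo c ≠ 0 := by
      intro h0
      obtain ⟨i, hi⟩ := hY0
      exact hi (by rw [h, h0, zero_mul])
    have hz' : ∀ i, 2 ^ (n - 1) * reflv α x i = toReal (z i) := fun i => by
      have h' := hr i
      rw [hpow, hz, add_sub_cancel_left, map_mul, map_ofNat] at h'
      linarith
    have := inDot_of_reflection_eq_two_mul hn hβ hY hc hc0
      (z := z) (fun i => by rw [hz, add_sub_cancel_left])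
    have := (mem_sphSdot_iff (1 - ω) hz').2 (by simpa using this)
    simpa using this

theorem reflv_mem_sphS_iff {n : ℕ} (hn : n ≠ 0) {x α : Fin 4 → ℝ} {Y β : Fin 4 → GoldenInt}
    {c : GoldenInt} (hβ : IsRoot β) (hx : ∀ i, 2 ^ n * x i = toReal (Y i))
    (hα : ∀ i, 2 * α i = toReal (β i)) (hc : ∑ i, Y i * β i = 2 * c)
    (hY : ∑ i, Y i ^ 2 = 4 ^ n) (hYs : InSpan ω (fun i => modTwo (Y i))) :
    reflv α x ∈ sphS gr n ↔ ∃ i, modTwo (Y i) ≠ modTwo c * modTwo (β i) := by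
  rw [← toReal_omega, mem_sphS_iff hn ω (two_pow_mul_reflv hx hα hc), sum_reflection_sq hβ.sum_sq hc]
  have hs : InSpan ω (fun i => modTwo (Y i - c * β i)) := by
    simpa only [map_sub, map_mul] using hYs.sub_mul (e := modTwo c) hβ.inDot.inSpan
  simp only [hY, hs, modTwo_omega, true_and]
  simp only [map_sub, map_mul, sub_ne_zero]

/-- Twice the root with support pattern `σ`, all of whose signs are positive except the one
of the coordinate carrying the entry `j`. -/
def flipRoot (σ : Equiv.Perm (Fin 4)) (j : Fin 4) (i : Fin 4) : GoldenInt :=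
  (if σ i = j then -1 else 1) * quad ω (σ i)

theorem isRoot_flipRoot {σ : Equiv.Perm (Fin 4)} (hσ : Equiv.Perm.sign σ = 1) (j : Fin 4) :
    IsRoot (flipRoot σ j) :=
  ⟨σ, hσ, fun i => if σ i = j then -1 else 1, fun i => by dsimp only; split_ifs <;> simp, fun _ => rfl⟩

theorem modTwo_flipRoot (σ : Equiv.Perm (Fin 4)) (j i : Fin 4) :
    modTwo (flipRoot σ j i) = quad ω (σ i) := by
  rw [flipRoot, map_mul, modTwo_sign (by split_ifs <;> simp), one_mul, map_quad, modTwo_omega]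

theorem exists_sum_flipRoot {σ : Equiv.Perm (Fin 4)} (hσ : Equiv.Perm.sign σ = 1)
    {Y : Fin 4 → GoldenInt} (hY : InSpan ω (fun i => modTwo (Y i))) :
    ∃ c, ∀ j, ∑ i, Y i * flipRoot σ j i = 2 * (c - Y (σ.symm j) * quad ω j) := by
  obtain ⟨c, hc⟩ := (isRoot_flipRoot hσ 0).exists_sum_mul_eq hY
  have hbase (j : Fin 4) : ∑ i, Y i * flipRoot σ j i =
      ∑ i, Y i * quad ω (σ i) - 2 * (Y (σ.symm j) * quad ω j) := by
    have hi (i : Fin 4) : Y i * flipRoot σ j i = Y i * quad ω (σ i) -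
        if i = σ.symm j then 2 * (Y (σ.symm j) * quad ω j) else 0 := by
      simp only [flipRoot, Equiv.eq_symm_apply]
      split_ifs with h
      · rw [← h, Equiv.symm_apply_apply]
        ring
      · ring
    simp only [hi, Finset.sum_sub_distrib, Finset.sum_ite_eq', Finset.mem_univ, if_true]
  refine ⟨c, fun j => ?_⟩
  rw [hbase] at hc ⊢
  have h0 : quad (ω : GoldenInt) 0 = 0 := rfl
  rw [h0] at hc
  linear_combination hc

theorem exists_isRoot_modTwo_eq {Y : Fin 4 → GoldenInt} (hY : InDot ω (fun i => modTwo (Y i))) :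
    ∃ β c, IsRoot β ∧ (∀ i, modTwo (Y i) = modTwo (β i)) ∧ ∑ i, Y i * β i = 2 * c ∧
      modTwo c = 1 := by
  have hY' := hY.inSpan
  obtain ⟨σ, hσ, h⟩ := hY
  obtain ⟨c, hc⟩ := exists_sum_flipRoot hσ hY'
  have hj : ∀ e : GoldenModTwo, ∃ j, e - quad ω j * quad ω j = 1 := by decide
  obtain ⟨j, hj⟩ := hj (modTwo c)
  refine ⟨_, _, isRoot_flipRoot hσ j, fun i => (h i).trans (modTwo_flipRoot σ j i).symm, hc j, ?_⟩
  have := h (σ.symm j)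
  simp only [Equiv.apply_symm_apply] at this
  rw [map_sub, map_mul, map_quad, modTwo_omega, this, hj]

theorem IsRoot.eq_or_eq_neg {Y β β' : Fin 4 → GoldenInt} {c c' : GoldenInt} (hβ : IsRoot β)
    (hβ' : IsRoot β') (hY : ∀ i, modTwo (Y i) = modTwo (β i))
    (hY' : ∀ i, modTwo (Y i) = modTwo (β' i)) (hc : ∑ i, Y i * β i = 2 * c)
    (hc' : ∑ i, Y i * β' i = 2 * c') (hcc : modTwo c = modTwo c') : β = β' ∨ β = -β' := by
  obtain ⟨σ, -, ε, hε, h⟩ := hβ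
  obtain ⟨σ', -, ε', hε', h'⟩ := hβ'
  have hm (i : Fin 4) : modTwo (Y i) = quad ω (σ i) := by
    rw [hY, h, map_mul, modTwo_sign (hε i), one_mul, map_quad, modTwo_omega]
  have hm' (i : Fin 4) : modTwo (Y i) = quad ω (σ' i) := by
    rw [hY', h', map_mul, modTwo_sign (hε' i), one_mul, map_quad, modTwo_omega]
  obtain rfl : σ = σ' := by
    ext1 i
    exact quad_omega_injective ((hm i).symm.trans (hm' i))
  have hδ (i : Fin 4) : ∃ δ : GoldenInt, ∃ b : Bool, ε i - ε' i = 2 * δ ∧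
      modTwo δ = (if b then 1 else 0) ∧ ε i = (if b then -1 else 1) * ε' i := by
    rcases hε i with h | h <;> rcases hε' i with h' | h' <;> rw [h, h']
    · exact ⟨0, false, by simp, by simp, by simp⟩
    · exact ⟨1, true, by norm_num, by simp, by simp⟩
    · exact ⟨-1, true, by norm_num, modTwo_sign (.inr rfl), by simp⟩
    · exact ⟨0, false, by simp, by simp, by simp⟩
  choose δ b hδ hδb hb using hδ
  have hdiff : ∑ i, Y i * (δ i * quad ω (σ i)) = c - c' := by
    apply two_mul_cancel
    rw [Finset.mul_sum, mul_sub, ← hc, ← hc', ← Finset.sum_sub_distrib]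
    refine Finset.sum_congr rfl fun i _ => ?_
    rw [h, h']
    linear_combination -Y i * quad ω (σ i) * hδ i
  have hz : ∑ j, (quad ω j : GoldenModTwo) * ((if b (σ.symm j) then 1 else 0) * quad ω j) = 0 := by
    have := congrArg modTwo hdiff
    rw [map_sub, hcc, sub_self] at this
    simp only [map_sum, map_mul, map_quad, modTwo_omega, hm, hδb] at this
    rw [← Equiv.sum_comp σ]
    simpa only [Equiv.symm_apply_apply] using this
  have key : ∀ s : Fin 4 → Bool,
      ∑ j, (quad ω j : GoldenModTwo) * ((if s j then 1 else 0) * quad ω j) = 0 →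
      ∀ j, j ≠ 0 → s j = s 1 := by decide
  have hall := key (fun j => b (σ.symm j)) hz
  have hβe (i : Fin 4) : β i = (if b (σ.symm 1) then -1 else 1) * β' i := by
    rw [h, h', hb]
    by_cases hi : σ i = 0
    · rw [hi, show quad (ω : GoldenInt) 0 = 0 from rfl]
      simp
    · have := hall (σ i) hi
      simp only [Equiv.symm_apply_apply] at this
      rw [this, mul_assoc]
  cases hb1 : b (σ.symm 1)
  · left
    ext1 i
    simp [hβe, hb1]
  · right
    ext1 i
    simp [hβe, hb1]

theorem reflv_neg (α : Fin 4 → ℝ) : reflv (-α) = reflv α := by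
  funext x i
  simp [reflv]

/-- The condition that the reflection in `α` lowers the level of `Y / 2 ^ n`, with `a` the class of
half the inner product of `Y` with the root `2 α`. -/
def IsLowering (Y : Fin 4 → GoldenInt) (a : GoldenModTwo) (α : Fin 4 → ℝ) : Prop :=
  ∃ β c, IsRoot β ∧ (∀ i, 2 * α i = toReal (β i)) ∧ ∑ i, Y i * β i = 2 * c ∧ modTwo c = a ∧
    ∀ i, modTwo (Y i) = a * modTwo (β i)

theorem exists_isLowering {Y : Fin 4 → GoldenInt} (hY : InDot ω (fun i => modTwo (Y i)))
    {a : GoldenModTwo} (ha : a ≠ 0) : ∃ α, IsLowering Y a α := by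
  obtain ⟨u', hu⟩ := exists_mul_eq_one a ha
  obtain ⟨u, rfl⟩ := modTwo_surjective u'
  have huY : InDot ω (fun i => modTwo (u * Y i)) := by
    obtain ⟨p, q, h⟩ := hY.inSpan
    have h' (i : Fin 4) : modTwo (u * Y i) = modTwo u * p + modTwo u * q * quad ω i := by
      rw [map_mul]
      linear_combination modTwo u * h i
    refine (InSpan.inDot_or ⟨_, _, h'⟩).resolve_right ?_
    rintro ⟨e, he⟩
    obtain ⟨i, hi⟩ := hY.not_const (a * e)
    apply hi
    rw [← he, map_mul]
    linear_combination -modTwo (Y i) * hu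
  obtain ⟨β, c, hβ, hYβ, hc, hc1⟩ := exists_isRoot_modTwo_eq huY
  obtain ⟨c', hc'⟩ := hβ.exists_sum_mul_eq hY.inSpan
  have hcc : c = u * c' := by
    apply two_mul_cancel
    rw [← hc]
    simp only [mul_assoc, ← Finset.mul_sum, hc']
    ring
  rw [hcc, map_mul] at hc1
  refine ⟨fun i => toReal (β i) / 2, β, c', hβ, fun i => by ring, hc', ?_, fun i => ?_⟩
  · linear_combination a * hc1 - modTwo c' * hu
  · rw [← hYβ, map_mul]
    linear_combination -modTwo (Y i) * hu

theorem IsLowering.reflv_eq {Y : Fin 4 → GoldenInt} {a : GoldenModTwo} {α α' : Fin 4 → ℝ}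
    (ha : a ≠ 0) (h : IsLowering Y a α) (h' : IsLowering Y a α') : reflv α = reflv α' := by
  obtain ⟨β, c, hβ, hα, hc, hca, hY⟩ := h
  obtain ⟨β', c', hβ', hα', hc', hca', hY'⟩ := h'
  obtain ⟨u', hu⟩ := exists_mul_eq_one a ha
  obtain ⟨u, rfl⟩ := modTwo_surjective u'
  have hsum {b : Fin 4 → GoldenInt} {d : GoldenInt} (hd : ∑ i, Y i * b i = 2 * d) : ∑ i, u * Y i * b i = 2 * (u * d) := by
    simp only [mul_assoc, ← Finset.mul_sum, hd]
    ring
  have hmod {b : Fin 4 → GoldenInt} (hb : ∀ i, modTwo (Y i) = a * modTwo (b i)) (i : Fin 4) :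
      modTwo (u * Y i) = modTwo (b i) := by
    rw [map_mul, hb]
    linear_combination modTwo (b i) * hu
  rcases hβ.eq_or_eq_neg (Y := fun i => u * Y i) hβ' (hmod hY) (hmod hY') (hsum hc) (hsum hc')
    (by rw [map_mul, map_mul, hca, hca']) with rfl | rfl
  · congr 1
    ext1 i
    linarith [hα i, hα' i]
  · rw [← reflv_neg α']
    congr 1
    ext1 i
    have := hα i
    rw [Pi.neg_apply, map_neg] at this
    rw [Pi.neg_apply]
    linarith [hα' i]

theorem IsLowering.eq_of_reflv_eq {n : ℕ} {x : Fin 4 → ℝ} {Y : Fin 4 → GoldenInt}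
    (hx : ∀ i, 2 ^ n * x i = toReal (Y i)) {a a' : GoldenModTwo} {α α' : Fin 4 → ℝ}
    (h : IsLowering Y a α) (h' : IsLowering Y a' α') (hr : reflv α = reflv α') : a = a' := by
  obtain ⟨β, c, hβ, hα, hc, rfl, -⟩ := h
  obtain ⟨β', c', hβ', hα', hc', rfl, -⟩ := h'
  have hcβ (i : Fin 4) : c * β i = c' * β' i := by
    have h1 := two_pow_mul_reflv hx hα hc i
    rw [hr, two_pow_mul_reflv hx hα' hc' i] at h1
    linear_combination toReal_injective h1
  have hsq : c ^ 2 = c' ^ 2 := by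
    apply two_mul_cancel
    apply two_mul_cancel
    have h1 := hβ.sum_sq
    have h2 := hβ'.sum_sq
    have h3 : ∑ i, (c * β i) ^ 2 = ∑ i, (c' * β' i) ^ 2 := by simp only [hcβ]
    simp only [mul_pow, ← Finset.mul_sum, h1, h2] at h3
    linear_combination h3
  have hsq' := congrArg modTwo hsq
  rw [map_pow, map_pow] at hsq'
  have key : ∀ a b : GoldenModTwo, a ^ 2 = b ^ 2 → a = b := by decide
  exact key _ _ hsq'

theorem ncard_lowering {n : ℕ} (hn : 2 ≤ n) {x : Fin 4 → ℝ} (hx : x ∈ sphSdot gr n) :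
    Set.ncard {f : (Fin 4 → ℝ) → (Fin 4 → ℝ) |
      ∃ α ∈ DeltaSet gr \ Kset, f = reflv α ∧ f x ∈ sphSdot (1 - gr) (n - 1)} = 3 := by
  obtain ⟨Y, hY⟩ := exists_toReal_eq_of_mem_sphSdot hx
  rw [← toReal_omega, mem_sphSdot_iff ω hY, modTwo_omega] at hx
  obtain ⟨hsq, hdot⟩ := hx
  choose α hα using fun a : {a : GoldenModTwo // a ≠ 0} => exists_isLowering hdot a.2
  have hinj : Function.Injective fun a => reflv (α a) := fun a b hab =>
    Subtype.ext ((hα a).eq_of_reflv_eq hY (hα b) hab)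
  have hset : {f : (Fin 4 → ℝ) → (Fin 4 → ℝ) |
      ∃ α ∈ DeltaSet gr \ Kset, f = reflv α ∧ f x ∈ sphSdot (1 - gr) (n - 1)} =
      Set.range fun a => reflv (α a) := by
    ext f
    constructor
    · rintro ⟨γ, hγ, rfl, hf⟩
      obtain ⟨β, hβ, hγβ⟩ := isRoot_of_mem_DeltaSet hγ
      obtain ⟨c, hc⟩ := hβ.exists_sum_mul_eq hdot.inSpan
      rw [reflv_mem_sphSdot_iff hn hβ hY hγβ hc hsq hdot.exists_ne_zero] at hf
      have hc0 : modTwo c ≠ 0 := fun h0 => by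
        obtain ⟨i, hi⟩ := hdot.exists_ne_zero
        exact hi (by rw [hf, h0, zero_mul])
      exact ⟨⟨modTwo c, hc0⟩, (hα _).reflv_eq hc0 ⟨β, c, hβ, hγβ, hc, rfl, hf⟩⟩
    · rintro ⟨a, rfl⟩
      obtain ⟨β, c, hβ, hαβ, hc, hca, hYa⟩ := hα a
      refine ⟨α a, ?_, rfl, ?_⟩
      · convert hβ.mem_DeltaSet using 1
        ext1 i
        linarith [hαβ i]
      · exact (reflv_mem_sphSdot_iff hn hβ hY hαβ hc hsq hdot.exists_ne_zero).2 (by rwa [hca])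
  rw [hset, ← Set.image_univ, Set.ncard_image_of_injective _ hinj, Set.ncard_univ,
    Nat.card_eq_fintype_card]
  decide

theorem exists_reflv_mem_sphSdot {n : ℕ} (hn : n ≠ 0) {x : Fin 4 → ℝ}
    (hx : x ∈ sphS gr n \ sphSdot gr n) :
    ∃ α ∈ DeltaSet gr \ Kset, reflv α x ∈ sphSdot gr n := by
  obtain ⟨hS, hD⟩ := hx
  obtain ⟨Y, hY⟩ := exists_toReal_eq_of_mem_sphS hn hS
  rw [← toReal_omega, mem_sphS_iff hn ω hY, modTwo_omega] at hS
  rw [← toReal_omega, mem_sphSdot_iff ω hY, modTwo_omega] at hD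
  obtain ⟨hsq, hspan, hne⟩ := hS
  obtain ⟨e, he⟩ := hspan.inDot_or.resolve_left fun h => hD ⟨hsq, h⟩
  have he0 : e ≠ 0 := by
    obtain ⟨i, hi⟩ := hne
    rwa [← he i]
  obtain ⟨c₀, hc₀⟩ := exists_sum_flipRoot (σ := 1) (map_one _) hspan
  obtain ⟨j, hj⟩ : ∃ j, modTwo (c₀ - Y ((1 : Equiv.Perm (Fin 4)).symm j) * quad ω j) ≠ 0 := by
    have key : ∀ e c : GoldenModTwo, e ≠ 0 → ∃ j, c - e * quad ω j ≠ 0 := by decide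
    obtain ⟨j, hj⟩ := key e (modTwo c₀) he0
    exact ⟨j, by rwa [map_sub, map_mul, map_quad, modTwo_omega, he]⟩
  have hβ := isRoot_flipRoot (σ := 1) (map_one _) j
  refine ⟨_, hβ.mem_DeltaSet, ?_⟩
  rw [← toReal_omega, mem_sphSdot_iff ω
    (two_pow_mul_reflv hY (fun i => by ring) (hc₀ j)), modTwo_omega]
  refine ⟨(sum_reflection_sq hβ.sum_sq (hc₀ j)).trans hsq, ?_⟩
  generalize c₀ - Y ((1 : Equiv.Perm (Fin 4)).symm j) * quad ω j = c at hj
  have hs : InSpan ω (fun i => modTwo (Y i - c * flipRoot 1 j i)) := by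
    simpa only [map_sub, map_mul] using hspan.sub_mul (e := modTwo c) hβ.inDot.inSpan
  refine hs.inDot_or.resolve_right ?_
  rintro ⟨d, hd⟩
  obtain ⟨u, hu⟩ := exists_mul_eq_one _ hj
  obtain ⟨i, hi⟩ := hβ.inDot.not_const (u * (e - d))
  apply hi
  have hdi := hd i
  simp only [map_sub, map_mul] at hdi
  linear_combination -modTwo (flipRoot 1 j i) * hu - u * hdi + u * he i

theorem statement8 (n : ℕ) (hn : 2 ≤ n) :
    (∀ α ∈ DeltaSet gr \ Kset, ∀ x ∈ sphS gr n,
        reflv α x ∈ sphS gr n ∪ sphSdot (1 - gr) (n - 1)) ∧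
    ((∀ α ∈ DeltaSet gr \ Kset, ∀ x ∈ sphS gr n \ sphSdot gr n,
        reflv α x ∈ sphS gr n) ∧
      (∀ x ∈ sphS gr n \ sphSdot gr n,
        ∃ α ∈ DeltaSet gr \ Kset, reflv α x ∈ sphSdot gr n)) ∧
    (∀ x ∈ sphSdot gr n,
      Set.ncard {f : (Fin 4 → ℝ) → (Fin 4 → ℝ) |
        ∃ α ∈ DeltaSet gr \ Kset, f = reflv α ∧ f x ∈ sphSdot (1 - gr) (n - 1)} = 3) := by
  have hn0 : n ≠ 0 := by omega
  have hi : ∀ α ∈ DeltaSet gr \ Kset, ∀ x ∈ sphS gr n,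
      reflv α x ∈ sphS gr n ∨ reflv α x ∈ sphSdot (1 - gr) (n - 1) ∧ x ∈ sphSdot gr n := by
    intro α hα x hx
    obtain ⟨Y, hY⟩ := exists_toReal_eq_of_mem_sphS hn0 hx
    rw [← toReal_omega, mem_sphS_iff hn0 ω hY, modTwo_omega] at hx
    obtain ⟨hsq, hspan, hne⟩ := hx
    obtain ⟨β, hβ, hαβ⟩ := isRoot_of_mem_DeltaSet hα
    obtain ⟨c, hc⟩ := hβ.exists_sum_mul_eq hspan
    rw [reflv_mem_sphS_iff hn0 hβ hY hαβ hc hsq hspan,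
      reflv_mem_sphSdot_iff hn hβ hY hαβ hc hsq hne]
    by_cases h : ∃ i, modTwo (Y i) ≠ modTwo c * modTwo (β i)
    · exact .inl h
    · push Not at h
      refine .inr ⟨h, ?_⟩
      have hc0 : modTwo c ≠ 0 := fun h0 => by
        obtain ⟨i, hi⟩ := hne
        exact hi (by rw [h, h0, zero_mul])
      rw [← toReal_omega, mem_sphSdot_iff ω hY, modTwo_omega]
      refine ⟨hsq, hspan.inDot_or.resolve_right ?_⟩
      rintro ⟨e, he⟩
      obtain ⟨u, hu⟩ := exists_mul_eq_one _ hc0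
      obtain ⟨i, hi⟩ := hβ.inDot.not_const (u * e)
      apply hi
      linear_combination -modTwo (β i) * hu - u * h i + u * he i
  refine ⟨fun α hα x hx => (hi α hα x hx).imp id And.left, ⟨fun α hα x hx => ?_, fun x hx =>
    exists_reflv_mem_sphSdot hn0 hx⟩, fun x hx => ncard_lowering hn hx⟩
  exact (hi α hα x hx.1).resolve_right fun h => hx.2 h.2
end
end
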